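/- For every δ > 0 and every integer ϵ > 0 there exists a constant c₁ = c₁(G,S,δ,ϵ) > 0 such that the following holds. Let G be an almost torsion-free group with finite generating set S whose Cayley graph X = Γ(G,S) is δ-hyperbolic, and let U be an ϵ-quasiconvex infinite subgroup of G. Then U (regarded as the subset of vertices of X) and the convex hull X(U) (formed in X relative to the constant δ) are c₁-Hausdorff close. -/

import Mathlib

noncomputable section

namespace KW

open Metric Set Pointwise

variable {X : Type*} [MetricSpace X]

/-- `s` is (the image of) a unit-speed geodesic segment joining `x` to `y`. -/
def IsGeodesicSegment (s : Set X) (x y : X) : Prop :=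
  ∃ (b : ℝ) (f : ℝ → X), 0 ≤ b ∧ f 0 = x ∧ f b = y ∧
    (∀ u ∈ Set.Icc (0 : ℝ) b, ∀ v ∈ Set.Icc (0 : ℝ) b, dist (f u) (f v) = |u - v|) ∧
    s = f '' Set.Icc 0 b

/-- A geodesic metric space. -/
def GeodesicSpace (X : Type*) [MetricSpace X] : Prop :=
  ∀ x y : X, ∃ s : Set X, IsGeodesicSegment s x y

/-- `X` is `δ`-hyperbolic: geodesic, and every geodesic triangle is `δ`-thin. -/
def DeltaHyperbolic (δ : ℝ) (X : Type*) [MetricSpace X] : Prop :=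
  GeodesicSpace X ∧
    ∀ (x y z : X) (s₁ s₂ s₃ : Set X),
      IsGeodesicSegment s₁ x y → IsGeodesicSegment s₂ y z → IsGeodesicSegment s₃ x z →
      ∀ p ∈ s₁, ∃ q ∈ s₂ ∪ s₃, dist p q ≤ δ

/-- `A` is an `ε`-quasiconvex subset of `X`. -/
def Quasiconvex (ε : ℝ) (A : Set X) : Prop :=
  ∀ x ∈ A, ∀ y ∈ A, ∀ s : Set X, IsGeodesicSegment s x y → ∀ p ∈ s, ∃ a ∈ A, dist p a ≤ ε

/-- The Gromov product `(y,z)_x`. -/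
def gromov (x y z : X) : ℝ := (dist y x + dist z x - dist y z) / 2

def IsGeodesicRay (γ : ℝ → X) : Prop :=
  ∀ s t : ℝ, 0 ≤ s → 0 ≤ t → dist (γ s) (γ t) = |s - t|

def IsBiGeodesic (γ : ℝ → X) : Prop :=
  ∀ s t : ℝ, dist (γ s) (γ t) = |s - t|

/-- `A` and `B` are `K`-Hausdorff close. -/
def HClose (K : ℝ) (A B : Set X) : Prop :=
  (∀ a ∈ A, ∃ b ∈ B, dist a b ≤ K) ∧ ∀ b ∈ B, ∃ a ∈ A, dist a b ≤ K

def HausdorffClose (A B : Set X) : Prop := ∃ K : ℝ, HClose K A B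

/-- Two geodesic rays are asymptotic iff their images are Hausdorff close. -/
def Asymptotic (γ γ' : ℝ → X) : Prop :=
  HausdorffClose (γ '' Set.Ici 0) (γ' '' Set.Ici 0)

def GRay (X : Type*) [MetricSpace X] : Type _ := {γ : ℝ → X // IsGeodesicRay γ}

theorem asymptotic_refl (γ : ℝ → X) : Asymptotic γ γ :=
  ⟨0, fun a ha => ⟨a, ha, by simp⟩, fun b hb => ⟨b, hb, by simp⟩⟩

theorem asymptotic_symm {γ γ' : ℝ → X} (h : Asymptotic γ γ') : Asymptotic γ' γ := by
  obtain ⟨K, h₁, h₂⟩ := h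
  refine ⟨K, fun a ha => ?_, fun b hb => ?_⟩
  · obtain ⟨b, hb, hd⟩ := h₂ a ha
    exact ⟨b, hb, by rwa [dist_comm]⟩
  · obtain ⟨a, ha, hd⟩ := h₁ b hb
    exact ⟨a, ha, by rwa [dist_comm]⟩

theorem asymptotic_trans {γ₁ γ₂ γ₃ : ℝ → X} (h : Asymptotic γ₁ γ₂)
    (h' : Asymptotic γ₂ γ₃) : Asymptotic γ₁ γ₃ := by
  obtain ⟨K, h₁, h₂⟩ := h
  obtain ⟨K', h₁', h₂'⟩ := h'
  refine ⟨K + K', fun a ha => ?_, fun c hc => ?_⟩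
  · obtain ⟨b, hb, hab⟩ := h₁ a ha
    obtain ⟨c, hc, hbc⟩ := h₁' b hb
    exact ⟨c, hc, (dist_triangle a b c).trans (by linarith)⟩
  · obtain ⟨b, hb, hbc⟩ := h₂' c hc
    obtain ⟨a, ha, hab⟩ := h₂ b hb
    exact ⟨a, ha, (dist_triangle a b c).trans (by linarith)⟩

def raySetoid (X : Type*) [MetricSpace X] : Setoid (GRay X) where
  r γ γ' := Asymptotic γ.1 γ'.1
  iseqv := ⟨fun γ => asymptotic_refl γ.1, fun h => asymptotic_symm h,
    fun h h' => asymptotic_trans h h'⟩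

/-- The (geodesic) boundary of `X`: asymptoty classes of geodesic rays. -/
def Boundary (X : Type*) [MetricSpace X] : Type _ := Quotient (raySetoid X)

def Boundary.mk {X : Type*} [MetricSpace X] (γ : GRay X) : Boundary X :=
  Quotient.mk (raySetoid X) γ

/-- A strongly geodesic metric space. -/
def StronglyGeodesic (X : Type*) [MetricSpace X] : Prop :=
  GeodesicSpace X ∧
  (∀ γ : ℝ → X, IsGeodesicRay γ → ∀ y : X,
      ∃ γ' : ℝ → X, IsGeodesicRay γ' ∧ γ' 0 = y ∧ Asymptotic γ γ') ∧
  (∀ γ₁ γ₂ : ℝ → X, IsGeodesicRay γ₁ → IsGeodesicRay γ₂ → γ₁ 0 = γ₂ 0 →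
      ¬ Asymptotic γ₁ γ₂ →
      ∃ γ : ℝ → X, IsBiGeodesic γ ∧
        HausdorffClose (Set.range γ) (γ₁ '' Set.Ici 0 ∪ γ₂ '' Set.Ici 0)) ∧
  (∀ (x : X) (u : ℕ → X),
      (∀ M : ℝ, ∃ N : ℕ, ∀ n, N ≤ n → ∀ m, N ≤ m → M ≤ gromov x (u n) (u m)) →
      ∃ γ : ℝ → X, IsGeodesicRay γ ∧ γ 0 = x ∧
        ∀ M : ℝ, ∃ N : ℕ, ∀ n, N ≤ n → ∀ m, N ≤ m → M ≤ gromov x (γ (n : ℝ)) (u m))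

/-- The sequence `u` converges to the boundary point `p`, with basepoint `x`. -/
def SeqConvTo (x : X) (u : ℕ → X) (p : Boundary X) : Prop :=
  ∃ γ : GRay X, Boundary.mk γ = p ∧
    ∀ M : ℝ, ∃ N : ℕ, ∀ n, N ≤ n → ∀ m, N ≤ m → M ≤ gromov x (u n) (γ.1 (m : ℝ))

/-- `γ` is a geodesic ray in the class of the boundary point `p`. -/
def RayTo (γ : ℝ → X) (p : Boundary X) : Prop :=
  ∃ h : IsGeodesicRay γ, Boundary.mk ⟨γ, h⟩ = p

/-- `γ` is a biinfinite geodesic whose two ends converge to `p` and `q`. -/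
def BiGeodesicJoins (γ : ℝ → X) (p q : Boundary X) : Prop :=
  IsBiGeodesic γ ∧ SeqConvTo (γ 0) (fun n => γ (-(n : ℝ))) p ∧
    SeqConvTo (γ 0) (fun n => γ (n : ℝ)) q

/-- `s` is (the image of) a geodesic joining two points of `X ∪ ∂X`. -/
def JoinSet : X ⊕ Boundary X → X ⊕ Boundary X → Set X → Prop
  | Sum.inl x, Sum.inl y, s => IsGeodesicSegment s x y
  | Sum.inl x, Sum.inr p, s => ∃ γ : ℝ → X, γ 0 = x ∧ RayTo γ p ∧ s = γ '' Set.Ici 0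
  | Sum.inr p, Sum.inl x, s => ∃ γ : ℝ → X, γ 0 = x ∧ RayTo γ p ∧ s = γ '' Set.Ici 0
  | Sum.inr p, Sum.inr q, s => ∃ γ : ℝ → X, BiGeodesicJoins γ p q ∧ s = Set.range γ

/-- The convex hull `Conv(A)` of a subset `A ⊆ X ∪ ∂X`. -/
def geoConv (A : Set (X ⊕ Boundary X)) : Set X :=
  {x | (∃ a : X, A = {Sum.inl a} ∧ x = a) ∨
    ∃ p ∈ A, ∃ q ∈ A, p ≠ q ∧ ∃ s : Set X, JoinSet p q s ∧ x ∈ s}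

/-- The distance between two subsets of `X`. -/
def setDist (A B : Set X) : ℝ := sInf (Set.image2 dist A B)

/-- `a` is a projection of `p` on `A` (relative to `δ`). -/
def IsProjection (δ : ℝ) (A : Set X) (p a : X) : Prop :=
  a ∈ A ∧ ∀ a' ∈ A, dist p a ≤ dist p a' + δ

/-- `f` restricted to `[0,L]` is a unit-speed geodesic from `x` to `y`. -/
def GeodParam (f : ℝ → X) (L : ℝ) (x y : X) : Prop :=
  0 ≤ L ∧ f 0 = x ∧ f L = y ∧
    ∀ u ∈ Set.Icc (0 : ℝ) L, ∀ v ∈ Set.Icc (0 : ℝ) L, dist (f u) (f v) = |u - v|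

/-- Concatenation of three paths, the first on `[0,a]`, the second on `[0,b]`. -/
def concat3 (f₁ f₂ f₃ : ℝ → X) (a b : ℝ) : ℝ → X := fun t =>
  if t ≤ a then f₁ t else if t ≤ a + b then f₂ (t - a) else f₃ (t - a - b)

/-- `f` is a `(lam, ε)`-quasigeodesic on `[a,b]`. -/
def QuasigeodesicOn (lam ε : ℝ) (f : ℝ → X) (a b : ℝ) : Prop :=
  ∀ s ∈ Set.Icc a b, ∀ t ∈ Set.Icc a b, |s - t| ≤ lam * dist (f s) (f t) + ε

/-- The action of `G` on `X` is by isometries. -/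
def IsometricAction (G Y : Type*) [Group G] [MetricSpace Y] [MulAction G Y] : Prop :=
  ∀ (g : G) (x y : Y), dist (g • x) (g • y) = dist x y

section GroupAction

variable {G : Type*} [Group G]

/-- The limit set `Λ(U) ⊆ ∂X` of a subgroup `U ≤ G`. -/
def limitSet (X : Type*) [MetricSpace X] [MulAction G X] (U : Subgroup G) :
    Set (Boundary X) :=
  {p | ∃ x₀ : X, ∃ u : ℕ → U, SeqConvTo x₀ (fun n => ((u n : G)) • x₀) p}

/-- The small displacement set `E(U)` (relative to `δ`). -/
def smallDispSet (X : Type*) [MetricSpace X] [MulAction G X] (δ : ℝ) (U : Subgroup G) :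
    Set X :=
  {x | ∃ u : G, u ∈ U ∧ u ≠ 1 ∧ dist x (u • x) ≤ 100 * δ}

/-- `Z(U) = Conv(Λ(U) ∪ E(U))`. -/
def ZSet (X : Type*) [MetricSpace X] [MulAction G X] (δ : ℝ) (U : Subgroup G) : Set X :=
  geoConv (Sum.inr '' limitSet X U ∪ Sum.inl '' smallDispSet X δ U)

/-- The convex hull `X(U)`: the closure of `Conv(Z(U))`. -/
def cHull (X : Type*) [MetricSpace X] [MulAction G X] (δ : ℝ) (U : Subgroup G) : Set X :=
  closure (geoConv (Sum.inl '' ZSet X δ U))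

/-- The weak convex hull `X_U = Conv(Λ(U))`. -/
def weakHull (X : Type*) [MetricSpace X] [MulAction G X] (U : Subgroup G) : Set X :=
  geoConv (Sum.inr '' limitSet X U)

/-- `l_V(g) = d(X(V), gX(V))`. -/
def lV (X : Type*) [MetricSpace X] [MulAction G X] (δ : ℝ) (V : Subgroup G) (g : G) : ℝ :=
  setDist (cHull X δ V) (g • cHull X δ V)

/-- The translation length of `g`. -/
def translationLength (X : Type*) [MetricSpace X] [MulAction G X] (g : G) : ℝ :=
  sInf (Set.range fun x : X => dist x (g • x))

/-- The asymptotic translation length of `g`. -/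
def asympTranslationLength (X : Type*) [MetricSpace X] [MulAction G X] (g : G) : ℝ :=
  Filter.liminf (fun n : ℕ => translationLength X (g ^ n) / (n : ℝ)) Filter.atTop

/-- An elementary move between `G`-tuples `(U₁,…,U_n; h₁,…,h_m)`. -/
def gMove {n m : ℕ} (M M' : (Fin n → Subgroup G) × (Fin m → G)) : Prop :=
  (M'.2 = M.2 ∧ ∃ (j : Fin n) (g : G),
      g ∈ Subgroup.closure (Set.range M.2 ∪ ⋃ i ∈ {i : Fin n | i ≠ j}, ((M.1 i : Set G))) ∧
      (∀ i, i ≠ j → M'.1 i = M.1 i) ∧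
      M'.1 j = Subgroup.map (MulAut.conj g).toMonoidHom (M.1 j)) ∨
  (M'.1 = M.1 ∧ ∃ (i : Fin m) (g₁ g₂ : G),
      g₁ ∈ Subgroup.closure (M.2 '' {j : Fin m | j ≠ i} ∪ ⋃ t, ((M.1 t : Set G))) ∧
      g₂ ∈ Subgroup.closure (M.2 '' {j : Fin m | j ≠ i} ∪ ⋃ t, ((M.1 t : Set G))) ∧
      (∀ j, j ≠ i → M'.2 j = M.2 j) ∧
      M'.2 i = g₁ * M.2 i * g₂)

/-- Equivalence of `G`-tuples: a finite chain of elementary moves. -/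
def gEquiv {n m : ℕ} :
    (Fin n → Subgroup G) × (Fin m → G) → (Fin n → Subgroup G) × (Fin m → G) → Prop :=
  Relation.ReflTransGen gMove

/-- The family of factors `U₁,…,U_n, F(h₁),…,F(h_m)`. -/
def FF {n : ℕ} (m : ℕ) (U : Fin n → Subgroup G) : Fin n ⊕ Fin m → Type _
  | Sum.inl j => ↥(U j)
  | Sum.inr _ => FreeGroup PUnit

instance ffGroup {n : ℕ} (m : ℕ) (U : Fin n → Subgroup G) :
    (i : Fin n ⊕ Fin m) → Group (FF m U i)
  | Sum.inl j => inferInstanceAs (Group ↥(U j))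
  | Sum.inr _ => inferInstanceAs (Group (FreeGroup PUnit))

def ffHoms {n m : ℕ} (U : Fin n → Subgroup G) (H : Fin m → G) :
    (i : Fin n ⊕ Fin m) → FF m U i →* G
  | Sum.inl j => (U j).subtype
  | Sum.inr j => FreeGroup.lift fun _ => H j

/-- The canonical homomorphism `U₁ ∗ ⋯ ∗ U_n ∗ F(H) → G`. -/
def freeProdHom {n m : ℕ} (U : Fin n → Subgroup G) (H : Fin m → G) :
    Monoid.CoprodI (FF m U) →* G :=
  Monoid.CoprodI.lift (ffHoms U H)

/-- `W = U₁ ∗ ⋯ ∗ U_n ∗ F(H)`: the canonical homomorphism is injective with image `W`. -/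
def IsFreeProdDecomp {n m : ℕ} (U : Fin n → Subgroup G) (H : Fin m → G)
    (W : Subgroup G) : Prop :=
  Function.Injective (freeProdHom U H) ∧ (freeProdHom U H).range = W

/-- Minimality of the `G`-pair `(V; H)` (relative to a `1`-hyperbolic `G`-space `X`). -/
def PairMinimal (X : Type*) [MetricSpace X] [MulAction G X] {m : ℕ}
    (V : Subgroup G) (H : Fin m → G) : Prop :=
  ∀ (V' : Subgroup G) (H' : Fin m → G),
    gEquiv ((fun _ : Fin 1 => V), H) ((fun _ : Fin 1 => V'), H') →
    (∑ i, lV X 1 V (H i)) ≤ (∑ i, lV X 1 V' (H' i)) + 1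

/-- An elementary Nielsen move on tuples of elements of `G`. -/
def NielsenMove {k : ℕ} (g g' : Fin k → G) : Prop :=
  (∃ i : Fin k, (∀ j, j ≠ i → g' j = g j) ∧ g' i = (g i)⁻¹) ∨
  (∃ i j : Fin k, i ≠ j ∧ (∀ t, t ≠ i → g' t = g t) ∧ g' i = g i * g j) ∨
  (∃ i j : Fin k, i ≠ j ∧ g' = g ∘ Equiv.swap i j)

/-- Nielsen equivalence: a finite chain of elementary Nielsen moves. -/
def NielsenEq {k : ℕ} : (Fin k → G) → (Fin k → G) → Prop :=
  Relation.ReflTransGen NielsenMove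

/-- Word length of `g` with respect to the (symmetrized) generating set `S`. -/
def wordLength (S : Set G) (g : G) : ℕ :=
  sInf {n : ℕ | ∃ f : Fin n → G, (∀ i, f i ∈ S ∨ (f i)⁻¹ ∈ S) ∧ (List.ofFn f).prod = g}

/-- `(X, ι)` is a model of the Cayley graph `Γ(G,S)`. -/
def IsCayleyGraph (G : Type*) [Group G] (S : Set G) (X : Type*) [MetricSpace X]
    [MulAction G X] (ι : G → X) : Prop :=
  IsometricAction G X ∧
  (∀ g h : G, ι (g * h) = g • ι h) ∧
  Function.Injective ι ∧
  GeodesicSpace X ∧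
  (∀ g h : G, dist (ι g) (ι h) = (wordLength S (g⁻¹ * h) : ℝ)) ∧
  ∀ x : X, ∃ g h : G, wordLength S (g⁻¹ * h) ≤ 1 ∧
    ∃ s : Set X, IsGeodesicSegment s (ι g) (ι h) ∧ x ∈ s

/-- `H` is a quasiconvex subgroup (with respect to the Cayley graph model `(X, ι)`). -/
def QCSubgroup (X : Type*) [MetricSpace X] (ι : G → X) (H : Subgroup G) : Prop :=
  ∃ ε : ℝ, 0 ≤ ε ∧ Quasiconvex ε (ι '' (H : Set G))

end GroupAction

/-- Every nontrivial element of finite order has finite centralizer. -/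
def AlmostTorsionFree (G : Type*) [Group G] : Prop :=
  ∀ g : G, g ≠ 1 → IsOfFinOrder g → ((Subgroup.centralizer {g} : Subgroup G) : Set G).Finite

/-- `U` is nontrivial and admits no nontrivial free product decomposition. -/
def FreelyIndecomposable (U : Type*) [Group U] : Prop :=
  Nontrivial U ∧
    ¬ ∃ A B : Subgroup U, A ≠ ⊥ ∧ B ≠ ⊥ ∧
        Function.Bijective (Monoid.Coprod.lift A.subtype B.subtype)

def InfiniteCyclic (U : Type*) [Group U] : Prop := Infinite U ∧ IsCyclic U

def VirtuallyCyclic (U : Type*) [Group U] : Prop :=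
  ∃ H : Subgroup U, H.index ≠ 0 ∧ IsCyclic ↥H

def NonElementary (U : Type*) [Group U] : Prop := ¬ Finite U ∧ ¬ VirtuallyCyclic U

end KW

universe u v

namespace KW

open Pointwise Metric Set

section Helpers

variable {X : Type*} [MetricSpace X]

theorem seg_symm {s : Set X} {x y : X} (h : IsGeodesicSegment s x y) :
    IsGeodesicSegment s y x := by
  obtain ⟨b, f, hb, h0, h1, hd, rfl⟩ := h
  refine ⟨b, fun t => f (b - t), hb, by simpa using h1, by simpa using h0, ?_, ?_⟩
  · intro u hu v hv
    simp only [Set.mem_Icc] at hu hv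
    rw [hd _ ⟨by linarith, by linarith⟩ _ ⟨by linarith, by linarith⟩, abs_sub_comm]
    congr 1; ring
  · ext p
    constructor
    · rintro ⟨t, ht, rfl⟩
      simp only [Set.mem_Icc] at ht
      exact ⟨b - t, ⟨by linarith, by linarith⟩, by simp⟩
    · rintro ⟨t, ht, rfl⟩
      simp only [Set.mem_Icc] at ht
      exact ⟨b - t, ⟨by linarith, by linarith⟩, by simp⟩

theorem seg_dist {s : Set X} {x y p : X} (h : IsGeodesicSegment s x y) (hp : p ∈ s) :
    dist x p + dist p y = dist x y := by
  obtain ⟨b, f, hb, rfl, rfl, hd, rfl⟩ := h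
  obtain ⟨t, ht, rfl⟩ := hp
  have ht' := ht
  simp only [Set.mem_Icc] at ht'
  rw [hd 0 ⟨le_rfl, hb⟩ t ht, hd t ht b ⟨hb, le_rfl⟩, hd 0 ⟨le_rfl, hb⟩ b ⟨hb, le_rfl⟩,
    abs_of_nonpos (by linarith), abs_of_nonpos (by linarith), abs_of_nonpos (by linarith)]
  ring

/-- a parametrisation of length exactly the distance -/
theorem geod_param (hX : GeodesicSpace X) (x y : X) :
    ∃ f : ℝ → X, f 0 = x ∧ f (dist x y) = y ∧
      ∀ u ∈ Set.Icc (0 : ℝ) (dist x y), ∀ v ∈ Set.Icc (0 : ℝ) (dist x y),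
        dist (f u) (f v) = |u - v| := by
  obtain ⟨s, b, f, hb, h0, h1, hd, -⟩ := hX x y
  have : dist x y = b := by
    rw [← h0, ← h1, hd 0 ⟨le_rfl, hb⟩ b ⟨hb, le_rfl⟩, abs_of_nonpos (by linarith)]; ring
  rw [this]
  exact ⟨f, h0, h1, hd⟩

theorem seg_through (hX : GeodesicSpace X) {x y z : X} (h : dist x z = dist x y + dist y z) :
    ∃ s, IsGeodesicSegment s x z ∧ y ∈ s := by
  obtain ⟨f, f0, f1, hf⟩ := geod_param hX x y
  obtain ⟨g, g0, g1, hg⟩ := geod_param hX y z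
  set a := dist x y with ha
  set b := dist y z with hb
  have ha0 : 0 ≤ a := dist_nonneg
  have hb0 : 0 ≤ b := dist_nonneg
  let F : ℝ → X := fun t => if t ≤ a then f t else g (t - a)
  have F0 : F 0 = x := by simp [F, ha0, f0]
  have Fa : F a = y := by simp [F, f1]
  have Fb : F (a + b) = z := by
    by_cases hb' : b = 0
    · have : y = z := by rw [← dist_eq_zero]; linarith
      rw [hb', add_zero, Fa, this]
    · have : ¬ (a + b ≤ a) := by
        have : 0 < b := lt_of_le_of_ne hb0 (Ne.symm hb')
        linarith
      simp only [F, if_neg this, add_sub_cancel_left, g1]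
  have up : ∀ u v, 0 ≤ u → u ≤ v → v ≤ a + b → dist (F u) (F v) ≤ v - u := by
    intro u v hu huv hv
    by_cases h1 : v ≤ a
    · have h2 : u ≤ a := huv.trans h1
      simp only [F, if_pos h1, if_pos h2]
      rw [hf u ⟨hu, h2⟩ v ⟨hu.trans huv, h1⟩, abs_of_nonpos (by linarith)]; linarith
    · push Not at h1
      by_cases h2 : u ≤ a
      · simp only [F, if_neg (not_le.2 h1), if_pos h2]
        have e1 := hf u ⟨hu, h2⟩ a ⟨ha0, le_rfl⟩
        have e2 := hg 0 ⟨le_rfl, hb0⟩ (v - a) ⟨by linarith, by linarith⟩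
        rw [abs_of_nonpos (by linarith)] at e1 e2
        rw [f1] at e1
        rw [g0] at e2
        linarith [dist_triangle (f u) y (g (v - a))]
      · push Not at h2
        simp only [F, if_neg (not_le.2 h1), if_neg (not_le.2 h2)]
        rw [hg (u - a) ⟨by linarith, by linarith⟩ (v - a) ⟨by linarith, by linarith⟩,
          abs_of_nonpos (by linarith)]; linarith
  have eqv : ∀ u v, 0 ≤ u → u ≤ v → v ≤ a + b → dist (F u) (F v) = v - u := by
    intro u v hu huv hv
    refine le_antisymm (up u v hu huv hv) ?_
    have e1 := up 0 u le_rfl hu (huv.trans hv)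
    have e2 := up v (a + b) (hu.trans huv) hv le_rfl
    rw [F0] at e1
    rw [Fb] at e2
    linarith [dist_triangle4 x (F u) (F v) z]
  refine ⟨F '' Set.Icc 0 (a + b), ⟨a + b, F, by linarith, F0, Fb, ?_, rfl⟩,
    ⟨a, ⟨ha0, by linarith⟩, Fa⟩⟩
  intro u hu v hv
  rcases le_total u v with huv | huv
  · rw [eqv u v hu.1 huv hv.2, abs_of_nonpos (by linarith)]; ring
  · rw [dist_comm, eqv v u hv.1 huv hu.2, abs_of_nonneg (by linarith)]

/-- `p` is within `r` of some geodesic from `a` to `b`. -/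
def Near (r : ℝ) (p a b : X) : Prop :=
  ∃ s q, IsGeodesicSegment s a b ∧ q ∈ s ∧ dist p q ≤ r

theorem Near.symm {r : ℝ} {p a b : X} (h : Near r p a b) : Near r p b a := by
  obtain ⟨s, q, hs, hq, hd⟩ := h
  exact ⟨s, q, seg_symm hs, hq, hd⟩

theorem Near.split {δ : ℝ} (hhyp : DeltaHyperbolic δ X) {r : ℝ} {p a b : X}
    (h : Near r p a b) (z : X) : Near (r + δ) p a z ∨ Near (r + δ) p z b := by
  obtain ⟨s, q, hs, hq, hd⟩ := h
  obtain ⟨s2, h2⟩ := hhyp.1 b z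
  obtain ⟨s3, h3⟩ := hhyp.1 a z
  obtain ⟨q', hq', hd'⟩ := hhyp.2 a b z s s2 s3 hs h2 h3 q hq
  have : dist p q' ≤ r + δ := (dist_triangle p q q').trans (by linarith)
  rcases hq' with hq' | hq'
  · exact Or.inr ⟨s2, q', seg_symm h2, hq', this⟩
  · exact Or.inl ⟨s3, q', h3, hq', this⟩

theorem Near.dist_le {r K : ℝ} {p a b : X} (h : Near r p a b) (hK : dist a b ≤ K) :
    dist p a ≤ r + K := by
  obtain ⟨s, q, hs, hq, hd⟩ := h
  have := seg_dist hs hq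
  have h1 : 0 ≤ dist q b := dist_nonneg
  rw [dist_comm a q] at this
  linarith [dist_triangle p q a]

theorem Near.gromov_le {r : ℝ} {p a b : X} (h : Near r p a b) (o : X) :
    gromov o a b ≤ dist o p + r := by
  obtain ⟨s, q, hs, hq, hd⟩ := h
  have := seg_dist hs hq
  unfold gromov
  have h1 := dist_triangle a q o
  have h2 := dist_triangle b q o
  have h3 := dist_triangle o p q
  rw [dist_comm b q, dist_comm q o] at h2
  rw [dist_comm q o] at h1
  linarith

theorem Near.qc {r e : ℝ} {A : Set X} (hA : Quasiconvex e A) {p a b : X} (h : Near r p a b)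
    (ha : a ∈ A) (hb : b ∈ A) : ∃ c ∈ A, dist p c ≤ r + e := by
  obtain ⟨s, q, hs, hq, hd⟩ := h
  obtain ⟨c, hc, hqc⟩ := hA a ha b hb s hs q hq
  exact ⟨c, hc, (dist_triangle p q c).trans (by linarith)⟩

def GInf (x : X) (a b : ℕ → X) : Prop :=
  ∀ M : ℝ, ∃ N : ℕ, ∀ n, N ≤ n → ∀ m, N ≤ m → M ≤ gromov x (a n) (b m)

def FarEq (a b : ℕ → X) : Prop :=
  ∀ (o : X) (R : ℝ), ∃ N : ℕ, ∀ n, N ≤ n → ∀ m, N ≤ m → ¬ Near R o (a n) (b m)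

theorem GInf.farEq {x : X} {a b : ℕ → X} (h : GInf x a b) : FarEq a b := by
  intro o R
  obtain ⟨N, hN⟩ := h (dist x o + R + 1)
  refine ⟨N, fun n hn m hm hnear => ?_⟩
  linarith [hN n hn m hm, hnear.gromov_le x]

theorem FarEq.symm {a b : ℕ → X} (h : FarEq a b) : FarEq b a := by
  intro o R
  obtain ⟨N, hN⟩ := h o R
  exact ⟨N, fun n hn m hm hnear => hN m hm n hn hnear.symm⟩

theorem FarEq.trans {δ : ℝ} (hhyp : DeltaHyperbolic δ X) {a b c : ℕ → X}
    (h : FarEq a b) (h' : FarEq b c) : FarEq a c := by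
  intro o R
  obtain ⟨N, hN⟩ := h o (R + δ)
  obtain ⟨N', hN'⟩ := h' o (R + δ)
  refine ⟨max N N', fun n hn m hm hnear => ?_⟩
  rcases hnear.split hhyp (b (max N N')) with h1 | h1
  · exact hN n ((le_max_left _ _).trans hn) _ (le_max_left _ _) h1
  · exact hN' _ (le_max_right _ _) m ((le_max_right _ _).trans hm) h1

theorem gromov_shift (x a a' b : X) : gromov x a' b - dist a a' ≤ gromov x a b := by
  unfold gromov
  have h1 := dist_triangle a' a x
  have h2 := dist_triangle a a' b
  rw [dist_comm a' a] at h1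
  linarith

theorem gromov_shift_base (x x' a b : X) : gromov x' a b - dist x x' ≤ gromov x a b := by
  unfold gromov
  have h1 := dist_triangle a x x'
  have h2 := dist_triangle b x x'
  linarith

theorem gromov_comm (x a b : X) : gromov x a b = gromov x b a := by
  unfold gromov; rw [dist_comm a b]; ring

theorem ray_gromov {γ : ℝ → X} (h : IsGeodesicRay γ) {s t : ℝ} (hs : 0 ≤ s) (ht : 0 ≤ t) :
    gromov (γ 0) (γ s) (γ t) = min s t := by
  unfold gromov
  rw [h s 0 hs le_rfl, h t 0 ht le_rfl, h s t hs ht, sub_zero, sub_zero, abs_of_nonneg hs,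
    abs_of_nonneg ht]
  rcases le_total s t with h | h
  · rw [min_eq_left h, abs_of_nonpos (by linarith)]; ring
  · rw [min_eq_right h, abs_of_nonneg (by linarith)]; ring

theorem asym_gInf {γ γ' : ℝ → X} (h : IsGeodesicRay γ) (h' : IsGeodesicRay γ')
    (ha : Asymptotic γ γ') : GInf (γ 0) (fun n => γ n) (fun n => γ' n) := by
  obtain ⟨K, -, hK⟩ := ha
  intro M
  obtain ⟨N, hN⟩ := exists_nat_ge (max M 0 + 2 * K + dist (γ 0) (γ' 0))
  refine ⟨N, fun n hn m hm => ?_⟩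
  have hn' : (N : ℝ) ≤ n := by exact_mod_cast hn
  have hm' : (N : ℝ) ≤ m := by exact_mod_cast hm
  obtain ⟨_, ⟨t, ht, rfl⟩, hd⟩ := hK (γ' m) ⟨m, by simp, rfl⟩
  have hK0 : 0 ≤ K := dist_nonneg.trans hd
  have ht : 0 ≤ t := ht
  have e1 := ray_gromov h (Nat.cast_nonneg n) ht
  have e2 := h' m 0 (Nat.cast_nonneg m) le_rfl
  have e3 := h t 0 ht le_rfl
  rw [sub_zero, abs_of_nonneg (Nat.cast_nonneg m)] at e2
  rw [sub_zero, abs_of_nonneg ht] at e3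
  have e4 := dist_triangle4 (γ' m) (γ t) (γ 0) (γ' 0)
  have e5 := gromov_shift (γ 0) (γ' m) (γ t) (γ n)
  rw [gromov_comm _ (γ' m), gromov_comm _ (γ t), e1] at e5
  rw [dist_comm (γ' m) (γ t)] at e4 e5
  have e6 : M + K ≤ min (n : ℝ) t := by
    have := le_max_left M 0
    have : 0 ≤ dist (γ 0) (γ' 0) := dist_nonneg
    apply le_min <;> linarith
  show M ≤ gromov (γ 0) (γ n) (γ' m)
  linarith

theorem ray_conv {γ : ℝ → X} {p : Boundary X} (h : RayTo γ p) :
    SeqConvTo (γ 0) (fun n => γ n) p := by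
  obtain ⟨h, rfl⟩ := h
  exact ⟨⟨γ, h⟩, rfl, asym_gInf h h (asymptotic_refl γ)⟩

theorem near_seg {δ e K : ℝ} (hδ : 0 < δ) (hhyp : DeltaHyperbolic δ X) (he : 0 ≤ e) {A : Set X}
    (hA : Quasiconvex e A) {x y a b p : X} (ha : a ∈ A) (hb : b ∈ A) (hxa : dist x a ≤ K)
    (hyb : dist y b ≤ K) (h : Near 0 p x y) : ∃ c ∈ A, dist p c ≤ 2 * δ + K + e := by
  have hK0 : 0 ≤ K := dist_nonneg.trans hxa
  rcases h.split hhyp a with h | h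
  · exact ⟨a, ha, (h.symm.dist_le (K := K) (by rwa [dist_comm])).trans (by linarith)⟩
  rcases h.split hhyp b with h | h
  · obtain ⟨c, hc, hd⟩ := h.qc hA ha hb
    exact ⟨c, hc, by linarith⟩
  · exact ⟨b, hb, (h.dist_le (K := K) (by rwa [dist_comm])).trans (by linarith)⟩

theorem near_ray {δ e K : ℝ} (hδ : 0 < δ) (hhyp : DeltaHyperbolic δ X) (he : 0 ≤ e) {A : Set X}
    (hA : Quasiconvex e A) {γ : ℝ → X} (hγ : IsGeodesicRay γ) {a : X} (ha : a ∈ A)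
    (h0 : dist (γ 0) a ≤ K) {b : ℕ → X} (hb : ∀ n, b n ∈ A) (hf : FarEq (fun n => γ n) b)
    {t : ℝ} (ht : 0 ≤ t) : ∃ c ∈ A, dist (γ t) c ≤ 2 * δ + K + e := by
  have hK0 : 0 ≤ K := dist_nonneg.trans h0
  obtain ⟨N, hN⟩ := hf (γ t) (0 + δ)
  obtain ⟨n, hn⟩ := exists_nat_ge (max (N : ℝ) t)
  have hn1 : N ≤ n := by exact_mod_cast (le_max_left _ _).trans hn
  have hn2 : t ≤ n := (le_max_right _ _).trans hn
  have h : Near 0 (γ t) (γ 0) (γ n) :=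
    ⟨γ '' Set.Icc 0 n, γ t, ⟨n, γ, Nat.cast_nonneg n, rfl, rfl,
      fun u hu v hv => hγ u v hu.1 hv.1, rfl⟩, ⟨t, ⟨ht, hn2⟩, rfl⟩, by simp⟩
  rcases h.split hhyp (b N) with h | h
  · rcases h.split hhyp a with h | h
    · exact ⟨a, ha, (h.symm.dist_le (K := K) (by rwa [dist_comm])).trans (by linarith)⟩
    · obtain ⟨c, hc, hd⟩ := h.qc hA ha (hb N)
      exact ⟨c, hc, by linarith⟩
  · exact absurd h.symm (hN n hn1 N le_rfl)

theorem near_bi {δ e : ℝ} (hhyp : DeltaHyperbolic δ X) {A : Set X}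
    (hA : Quasiconvex e A) {γ : ℝ → X} (hγ : IsBiGeodesic γ)
    {b b' : ℕ → X} (hb : ∀ n, b n ∈ A) (hb' : ∀ n, b' n ∈ A)
    (hf : FarEq (fun n => γ n) b) (hf' : FarEq (fun n => γ (-n)) b')
    (t : ℝ) : ∃ c ∈ A, dist (γ t) c ≤ 2 * δ + e := by
  obtain ⟨N, hN⟩ := hf (γ t) (0 + δ)
  obtain ⟨N', hN'⟩ := hf' (γ t) (0 + δ + δ)
  obtain ⟨n, hn⟩ := exists_nat_ge (max (max (N : ℝ) N') |t|)
  have hn1 : N ≤ n := by exact_mod_cast ((le_max_left _ _).trans (le_max_left _ _)).trans hn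
  have hn3 : N' ≤ n := by exact_mod_cast ((le_max_right _ _).trans (le_max_left _ _)).trans hn
  have hn2 := abs_le.1 ((le_max_right _ _).trans hn)
  have hn0 : (0 : ℝ) ≤ n := Nat.cast_nonneg n
  have h : Near 0 (γ t) (γ (-n)) (γ n) := by
    refine ⟨(fun u => γ (u - n)) '' Set.Icc 0 (2 * n), γ t,
      ⟨2 * n, fun u => γ (u - n), by linarith, by simp, by ring_nf, ?_, rfl⟩,
      ⟨t + n, ⟨by linarith, by linarith⟩, by simp⟩, by simp⟩
    intro u _ v _
    rw [hγ]
    congr 1; ring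
  rcases h.split hhyp (b N) with h | h
  · rcases h.split hhyp (b' N') with h | h
    · exact absurd h (hN' n hn3 N' le_rfl)
    · obtain ⟨c, hc, hd⟩ := h.qc hA (hb' N') (hb N)
      exact ⟨c, hc, by linarith⟩
  · exact absurd h.symm (hN n hn1 N le_rfl)

section Grp

variable {G : Type*} [Group G] [MulAction G X]

theorem smul_iota {S : Set G} {ι : G → X} (hCay : IsCayleyGraph G S X ι) (g : G) :
    g • ι 1 = ι g := by rw [← hCay.2.1, mul_one]

theorem dist_iota_left {S : Set G} {ι : G → X} (hCay : IsCayleyGraph G S X ι) (g a b : G) :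
    dist (ι (g * a)) (ι (g * b)) = dist (ι a) (ι b) := by
  rw [hCay.2.1, hCay.2.1, hCay.1]

theorem limit_farEq {δ : ℝ} (hhyp : DeltaHyperbolic δ X) {S : Set G} {ι : G → X}
    (hCay : IsCayleyGraph G S X ι) {U : Subgroup G} {p : Boundary X} (hp : p ∈ limitSet X U)
    {x : X} {a : ℕ → X} (ha : SeqConvTo x a p) :
    ∃ b : ℕ → X, (∀ n, b n ∈ ι '' (U : Set G)) ∧ FarEq a b := by
  obtain ⟨γ₁, h1, ha⟩ := ha
  obtain ⟨x₀, u, γ₂, h2, hu⟩ := hp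
  have has : Asymptotic γ₁.1 γ₂.1 := Quotient.exact (h1.trans h2.symm)
  refine ⟨fun n => ι (u n), fun n => ⟨u n, (u n).2, rfl⟩, ?_⟩
  have f1 : FarEq a (fun n => γ₁.1 n) := GInf.farEq ha
  have f2 := (asym_gInf γ₁.2 γ₂.2 has).farEq
  have f3 : FarEq (fun n => ι (u n)) (fun n => γ₂.1 n) := by
    refine GInf.farEq (x := x₀) ?_
    intro M
    obtain ⟨N, hN⟩ := hu (M + dist (ι 1) x₀)
    refine ⟨N, fun n hn m hm => ?_⟩
    have e := gromov_shift x₀ (ι (u n)) ((u n : G) • x₀) (γ₂.1 m)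
    rw [← smul_iota hCay, hCay.1] at e
    have := hN n hn m hm
    simp only at this ⊢
    rw [← smul_iota hCay]
    linarith
  exact (f1.trans hhyp f2).trans hhyp f3.symm

/-- `Z(U)` is near `U` if `E(U)` is, and similarly the hull. -/
theorem zset_near {δ e K : ℝ} (hδ : 0 < δ) (hhyp : DeltaHyperbolic δ X) (he : 0 ≤ e) (hK : 0 ≤ K)
    {S : Set G} {ι : G → X}
    (hCay : IsCayleyGraph G S X ι) {U : Subgroup G} (hA : Quasiconvex e (ι '' (U : Set G)))
    (hE : ∀ x ∈ smallDispSet X δ U, ∃ a ∈ ι '' (U : Set G), dist x a ≤ K) :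
    ∀ x ∈ ZSet X δ U, ∃ a ∈ ι '' (U : Set G), dist x a ≤ 2 * δ + K + e := by
  have hray : ∀ (γ : ℝ → X) (p : Boundary X), p ∈ limitSet X U → RayTo γ p →
      γ 0 ∈ smallDispSet X δ U → ∀ x ∈ γ '' Set.Ici 0,
      ∃ a ∈ ι '' (U : Set G), dist x a ≤ 2 * δ + K + e := by
    rintro γ p hp hγ h0 _ ⟨t, ht, rfl⟩
    obtain ⟨a, ha, h0a⟩ := hE _ h0
    obtain ⟨b, hb, hf⟩ := limit_farEq hhyp hCay hp (ray_conv hγ)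
    exact near_ray hδ hhyp he hA hγ.1 ha h0a hb hf ht
  rintro x (⟨a, ha, rfl⟩ | ⟨p, hp, q, hq, -, s, hs, hxs⟩)
  · have : (Sum.inl x : X ⊕ Boundary X) ∈ Sum.inr '' limitSet X U ∪
        Sum.inl '' smallDispSet X δ U := by rw [ha]; rfl
    rcases this with ⟨_, _, h⟩ | ⟨y, hy, h⟩
    · cases h
    · cases h
      obtain ⟨a, ha, h⟩ := hE _ hy
      exact ⟨a, ha, by linarith⟩
  · rcases hp with ⟨p, hp, rfl⟩ | ⟨p, hp, rfl⟩ <;> rcases hq with ⟨q, hq, rfl⟩ | ⟨q, hq, rfl⟩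
    · obtain ⟨γ, ⟨hγ, h1, h2⟩, rfl⟩ := hs
      obtain ⟨t, rfl⟩ := hxs
      obtain ⟨b, hb, hf⟩ := limit_farEq hhyp hCay hq h2
      obtain ⟨b', hb', hf'⟩ := limit_farEq hhyp hCay hp h1
      obtain ⟨c, hc, h⟩ := near_bi hhyp hA hγ hb hb' hf hf' t
      exact ⟨c, hc, by linarith⟩
    · obtain ⟨γ, rfl, h2, rfl⟩ := hs
      exact hray γ p hp h2 hq x hxs
    · obtain ⟨γ, rfl, h2, rfl⟩ := hs
      exact hray γ q hq h2 hp x hxs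
    · obtain ⟨a, ha, h1⟩ := hE _ hp
      obtain ⟨b, hb, h2⟩ := hE _ hq
      exact near_seg hδ hhyp he hA ha hb h1 h2 ⟨s, x, hs, hxs, by simp⟩

theorem hull_near {δ e K : ℝ} (hδ : 0 < δ) (hhyp : DeltaHyperbolic δ X) (he : 0 ≤ e) (hK : 0 ≤ K)
    {S : Set G} {ι : G → X}
    (hCay : IsCayleyGraph G S X ι) {U : Subgroup G} (hA : Quasiconvex e (ι '' (U : Set G)))
    (hE : ∀ x ∈ smallDispSet X δ U, ∃ a ∈ ι '' (U : Set G), dist x a ≤ K) :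
    ∀ x ∈ cHull X δ U, ∃ a ∈ ι '' (U : Set G), dist x a ≤ 4 * δ + K + 2 * e + 1 := by
  have hZ := zset_near hδ hhyp he hK hCay hA hE
  intro x hx
  obtain ⟨y, hy, hxy⟩ := Metric.mem_closure_iff.1 hx 1 one_pos
  suffices ∃ a ∈ ι '' (U : Set G), dist y a ≤ 2 * δ + (2 * δ + K + e) + e by
    obtain ⟨a, ha, h⟩ := this
    exact ⟨a, ha, (dist_triangle x y a).trans (by linarith)⟩
  rcases hy with ⟨a, ha, rfl⟩ | ⟨p, hp, q, hq, -, s, hs, hxs⟩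
  · have : (Sum.inl y : X ⊕ Boundary X) ∈ Sum.inl '' ZSet X δ U := by rw [ha]; rfl
    obtain ⟨z, hz, h⟩ := this
    cases h
    obtain ⟨a, ha, h⟩ := hZ _ hz
    exact ⟨a, ha, by linarith⟩
  · obtain ⟨p, hp, rfl⟩ := hp
    obtain ⟨q, hq, rfl⟩ := hq
    obtain ⟨a, ha, h1⟩ := hZ _ hp
    obtain ⟨b, hb, h2⟩ := hZ _ hq
    exact near_seg hδ hhyp he hA ha hb h1 h2 ⟨s, y, hs, hxs, by simp⟩

end Grp

end Helpers
section Helpers2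

variable {X : Type*} [MetricSpace X] {G : Type*} [Group G]

theorem exists_word (S : Set G) (hgen : Subgroup.closure S = ⊤) (g : G) :
    ∃ f : Fin (wordLength S g) → G, (∀ i, f i ∈ S ∨ (f i)⁻¹ ∈ S) ∧ (List.ofFn f).prod = g := by
  have hne : {n : ℕ | ∃ f : Fin n → G, (∀ i, f i ∈ S ∨ (f i)⁻¹ ∈ S) ∧
      (List.ofFn f).prod = g}.Nonempty := by
    have hg : g ∈ Subgroup.closure S := by rw [hgen]; trivial
    rw [← Subgroup.mem_toSubmonoid, Subgroup.closure_toSubmonoid] at hg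
    obtain ⟨l, hl, hp⟩ := Submonoid.exists_list_of_mem_closure hg
    exact ⟨l.length, fun i => l.get i, fun i => hl _ (List.get_mem l i), by rw [List.ofFn_get, hp]⟩
  exact Nat.sInf_mem hne

theorem wl_ball_finite (S : Finset G) (hgen : Subgroup.closure (S : Set G) = ⊤) (n : ℕ) :
    {g : G | wordLength (S : Set G) g ≤ n}.Finite := by
  have hT : {x : G | x ∈ (S : Set G) ∨ x⁻¹ ∈ (S : Set G)}.Finite := by
    have : {x : G | x ∈ (S : Set G) ∨ x⁻¹ ∈ (S : Set G)} = (S : Set G) ∪ (S : Set G)⁻¹ := rfl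
    rw [this]
    exact S.finite_toSet.union S.finite_toSet.inv
  refine Set.Finite.subset (Set.Finite.biUnion (Set.finite_Iic n) (t := fun k =>
    (fun f : Fin k → G => (List.ofFn f).prod) '' Set.pi Set.univ
      (fun _ => {x : G | x ∈ (S : Set G) ∨ x⁻¹ ∈ (S : Set G)}))
    (fun k _ => (Set.Finite.pi fun _ => hT).image _)) ?_
  intro g hg
  obtain ⟨f, hf, hp⟩ := exists_word (S : Set G) hgen g
  simp only [Set.mem_iUnion]
  exact ⟨_, hg, f, fun i _ => hf i, hp⟩

variable [MulAction G X]

theorem ball_finite {S : Finset G} (hgen : Subgroup.closure (S : Set G) = ⊤) {ι : G → X}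
    (hCay : IsCayleyGraph G (S : Set G) X ι) (h : G) (R : ℝ) :
    {g : G | dist (ι h) (ι g) ≤ R}.Finite := by
  have := (wl_ball_finite S hgen ⌊R⌋₊).image (fun x => h * x)
  refine this.subset ?_
  intro g hg
  refine ⟨h⁻¹ * g, ?_, by simp⟩
  have hg : dist (ι h) (ι g) ≤ R := hg
  rw [hCay.2.2.2.2.1] at hg
  exact Nat.le_floor hg

theorem near_min {r e : ℝ} {p y z a : X} (h : Near r p y z) (hm : dist z y ≤ dist z a)
    (hpa : dist p a ≤ e) : dist p y ≤ 2 * r + e := by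
  obtain ⟨s, q, hs, hq, hd⟩ := h
  have h1 := seg_dist hs hq
  have h2 := dist_triangle4 z q p a
  have h3 := dist_triangle p q y
  rw [dist_comm z q, dist_comm q p] at h2
  rw [dist_comm q y] at h3
  rw [dist_comm z y] at hm
  linarith

theorem core {S : Set G} {ι : G → X} (hCay : IsCayleyGraph G S X ι) {δ e : ℝ} (hδ : 0 < δ)
    (hhyp : DeltaHyperbolic δ X) {U : Subgroup G}
    (hA : Quasiconvex e (ι '' (U : Set G))) {g v : G} (hv : v ∈ U)
    (hmin : ∀ u ∈ U, dist (ι g) (ι 1) ≤ dist (ι g) (ι u)) {R : ℝ}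
    (hR : dist (ι g) (ι (v * g)) ≤ R) (hD : R + 2 * δ + e < dist (ι g) (ι 1)) :
    dist (ι 1) (ι v) ≤ 8 * δ + 2 * e := by
  obtain ⟨f, f0, f1, hf⟩ := geod_param hhyp.1 (ι 1) (ι v)
  set L := dist (ι 1) (ι v) with hL
  have hL0 : 0 ≤ L := dist_nonneg
  have d1 : dist (f (L / 2)) (ι 1) = L / 2 := by
    rw [← f0, hf _ ⟨by linarith, by linarith⟩ _ ⟨le_rfl, hL0⟩, abs_of_nonneg (by linarith)]; ring
  have d2 : dist (f (L / 2)) (ι v) = L / 2 := by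
    rw [← f1, hf _ ⟨by linarith, by linarith⟩ _ ⟨hL0, le_rfl⟩, abs_of_nonpos (by linarith)]; ring
  have hn : Near 0 (f (L / 2)) (ι 1) (ι v) :=
    ⟨f '' Set.Icc 0 L, f (L / 2), ⟨L, f, hL0, f0, f1, hf, rfl⟩,
      ⟨L / 2, ⟨by linarith, by linarith⟩, rfl⟩, by simp⟩
  obtain ⟨_, ⟨a, ha, rfl⟩, hpa⟩ := hn.qc hA ⟨1, U.one_mem, rfl⟩ ⟨v, hv, rfl⟩
  rcases hn.split hhyp (ι g) with h | h
  · have := near_min h (hmin a ha) hpa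
    linarith
  rcases h.split hhyp (ι (v * g)) with h | h
  · have := h.dist_le hR
    have h2 := hmin a ha
    have h3 := dist_triangle (ι g) (f (L / 2)) (ι a)
    rw [dist_comm (ι g) (f (L / 2))] at h3
    linarith
  · have hm : dist (ι (v * g)) (ι v) ≤ dist (ι (v * g)) (ι a) := by
      have h1 := dist_iota_left hCay v g 1
      have h2 := dist_iota_left hCay v g (v⁻¹ * a)
      rw [mul_one] at h1
      rw [mul_inv_cancel_left] at h2
      rw [h1, h2]
      exact hmin _ (U.mul_mem (U.inv_mem hv) ha)
    have := near_min h.symm hm hpa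
    linarith

theorem per_v {S : Finset G} (hgen : Subgroup.closure (S : Set G) = ⊤) {ι : G → X}
    (hCay : IsCayleyGraph G (S : Set G) X ι) {δ e : ℝ} (hδ : 0 < δ)
    (hhyp : DeltaHyperbolic δ X) (hATF : AlmostTorsionFree G) (R : ℝ) (v : G) (hv1 : v ≠ 1) :
    ∃ K : ℝ, ∀ U : Subgroup G, Quasiconvex e (ι '' (U : Set G)) → v ∈ U → ∀ g : G,
      (∀ u ∈ U, dist (ι g) (ι 1) ≤ dist (ι g) (ι u)) → dist (ι g) (ι (v * g)) ≤ R →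
      dist (ι g) (ι 1) ≤ K := by
  by_cases hfin : IsOfFinOrder v
  · have hc := hATF v hv1 hfin
    have hset : {g : G | dist (ι g) (ι (v * g)) ≤ R}.Finite := by
      refine Set.Finite.subset (Set.Finite.biUnion (ball_finite hgen hCay 1 R)
        (t := fun w => {g : G | g⁻¹ * (v * g) = w}) ?_) ?_
      · intro w _
        rcases Set.eq_empty_or_nonempty {g : G | g⁻¹ * (v * g) = w} with h0 | ⟨g₀, h0⟩
        · rw [h0]; exact Set.finite_empty
        · refine (hc.image (fun c => c * g₀)).subset ?_
          intro g hg
          refine ⟨g * g₀⁻¹, ?_, by simp⟩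
          have h0 : g₀⁻¹ * (v * g₀) = w := h0
          have hg : g⁻¹ * (v * g) = w := hg
          have h1 : v * g₀ = g₀ * w := by rw [← h0]; group
          have h2 : v * g = g * w := by rw [← hg]; group
          have h3 : g₀⁻¹ * v = w * g₀⁻¹ := by rw [← h0]; group
          rw [SetLike.mem_coe, Subgroup.mem_centralizer_singleton_iff]
          symm
          calc v * (g * g₀⁻¹) = (v * g) * g₀⁻¹ := by group
            _ = g * (w * g₀⁻¹) := by rw [h2]; group
            _ = g * g₀⁻¹ * v := by rw [← h3]; group
      · intro g hg
        simp only [Set.mem_iUnion]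
        refine ⟨g⁻¹ * (v * g), ?_, rfl⟩
        have := dist_iota_left hCay g 1 (g⁻¹ * (v * g))
        rw [mul_one, mul_inv_cancel_left] at this
        show _ ≤ R
        rw [← this]; exact hg
    obtain ⟨K, hK⟩ := (hset.image (fun g => dist (ι g) (ι 1))).bddAbove
    exact ⟨K, fun U _ _ g _ hg => hK ⟨g, hg, rfl⟩⟩
  · have hinj := injective_pow_iff_not_isOfFinOrder.2 hfin
    obtain ⟨n, hn⟩ : ∃ n : ℕ, 8 * δ + 2 * e < dist (ι 1) (ι (v ^ n)) := by
      by_contra! hcon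
      exact Set.infinite_of_injective_forall_mem hinj hcon (ball_finite hgen hCay 1 _)
    refine ⟨n * R + 2 * δ + e, fun U hA hvU g hmin hg => ?_⟩
    by_contra! hD
    have hpow : ∀ k : ℕ, dist (ι g) (ι (v ^ k * g)) ≤ k * R := by
      intro k
      induction k with
      | zero => simp
      | succ k ih =>
        have h1 := dist_iota_left hCay (v ^ k) g (v * g)
        have h2 := dist_triangle (ι g) (ι (v ^ k * g)) (ι (v ^ k * (v * g)))
        rw [pow_succ, mul_assoc]
        push_cast
        linarith
    have := core hCay hδ hhyp hA (U.pow_mem hvU n) hmin (hpow n) hD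
    linarith

theorem disp_near {S : Finset G} (hgen : Subgroup.closure (S : Set G) = ⊤) {ι : G → X}
    (hCay : IsCayleyGraph G (S : Set G) X ι) {δ e : ℝ} (hδ : 0 < δ)
    (hhyp : DeltaHyperbolic δ X) (hATF : AlmostTorsionFree G) :
    ∃ K : ℝ, 0 ≤ K ∧ ∀ U : Subgroup G, Quasiconvex e (ι '' (U : Set G)) →
      ∀ x ∈ smallDispSet X δ U, ∃ a ∈ ι '' (U : Set G), dist x a ≤ K := by
  set R := 100 * δ + 2 with hR
  have hch : ∀ v : G, ∃ K : ℝ, v ≠ 1 → ∀ U : Subgroup G, Quasiconvex e (ι '' (U : Set G)) →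
      v ∈ U → ∀ g : G,
      (∀ u ∈ U, dist (ι g) (ι 1) ≤ dist (ι g) (ι u)) → dist (ι g) (ι (v * g)) ≤ R →
      dist (ι g) (ι 1) ≤ K := by
    intro v
    by_cases hv : v = 1
    · exact ⟨0, fun h => absurd hv h⟩
    · obtain ⟨K, hK⟩ := per_v (e := e) hgen hCay hδ hhyp hATF R v hv
      exact ⟨K, fun _ => hK⟩
  choose Kf hKf using hch
  obtain ⟨K1, hK1⟩ := ((ball_finite hgen hCay 1 (8 * δ + 2 * e)).image Kf).bddAbove
  refine ⟨max 0 (max K1 (R + 2 * δ + e)) + 1,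
    by linarith [le_max_left 0 (max K1 (R + 2 * δ + e))], ?_⟩
  rintro U hA x ⟨u, hu, hu1, hux⟩
  obtain ⟨g, h, hgh, s, hs, hxs⟩ := hCay.2.2.2.2.2 x
  have hxg : dist (ι g) x ≤ 1 := by
    have h1 := seg_dist hs hxs
    have h2 : dist (ι g) (ι h) ≤ 1 := by
      rw [hCay.2.2.2.2.1]; exact_mod_cast hgh
    have : 0 ≤ dist x (ι h) := dist_nonneg
    linarith
  have hgu : dist (ι g) (ι (u * g)) ≤ R := by
    have h1 := dist_triangle4 (ι g) x (u • x) (u • ι g)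
    rw [hCay.1 u x (ι g), dist_comm x (ι g)] at h1
    rw [hCay.2.1]
    linarith
  -- nearest point
  obtain ⟨u₀, hu₀, hmin₀⟩ : ∃ u₀ ∈ U, ∀ u ∈ U, dist (ι g) (ι u₀) ≤ dist (ι g) (ι u) := by
    have hne : ((fun u => wordLength (S : Set G) (g⁻¹ * u)) '' (U : Set G)).Nonempty :=
      ⟨_, 1, U.one_mem, rfl⟩
    obtain ⟨u₀, hu₀, he⟩ := Nat.sInf_mem hne
    refine ⟨u₀, hu₀, fun u hu => ?_⟩
    rw [hCay.2.2.2.2.1, hCay.2.2.2.2.1]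
    have := Nat.sInf_le (s := (fun u => wordLength (S : Set G) (g⁻¹ * u)) '' (U : Set G))
      ⟨u, hu, rfl⟩
    simp only at he
    rw [← he] at this
    exact_mod_cast this
  refine ⟨ι u₀, ⟨u₀, hu₀, rfl⟩, ?_⟩
  set v := u₀⁻¹ * u * u₀ with hv
  have hvU : v ∈ U := U.mul_mem (U.mul_mem (U.inv_mem hu₀) hu) hu₀
  have hv1 : v ≠ 1 := by
    intro h
    apply hu1
    have : u = u₀ * v * u₀⁻¹ := by rw [hv]; group
    rw [this, h]; group
  have hmin : ∀ w ∈ U, dist (ι (u₀⁻¹ * g)) (ι 1) ≤ dist (ι (u₀⁻¹ * g)) (ι w) := by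
    intro w hw
    have h1 := dist_iota_left hCay u₀ (u₀⁻¹ * g) 1
    have h2 := dist_iota_left hCay u₀ (u₀⁻¹ * g) w
    rw [mul_inv_cancel_left, mul_one] at h1
    rw [mul_inv_cancel_left] at h2
    rw [← h1, ← h2]
    exact hmin₀ _ (U.mul_mem hu₀ hw)
  have hdv : dist (ι (u₀⁻¹ * g)) (ι (v * (u₀⁻¹ * g))) ≤ R := by
    have h1 := dist_iota_left hCay u₀⁻¹ g (u * g)
    have : v * (u₀⁻¹ * g) = u₀⁻¹ * (u * g) := by rw [hv]; group
    rw [this, h1]; exact hgu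
  have key : dist (ι (u₀⁻¹ * g)) (ι 1) ≤ max K1 (R + 2 * δ + e) := by
    by_contra! hcon
    have h1 := lt_of_le_of_lt (le_max_left _ _) hcon
    have h2 := lt_of_le_of_lt (le_max_right _ _) hcon
    have hc := core hCay hδ hhyp hA hvU hmin hdv h2
    have h3 := hKf v hv1 U hA hvU _ hmin hdv
    have h4 : Kf v ≤ K1 := hK1 ⟨v, hc, rfl⟩
    linarith
  have h1 := dist_iota_left hCay u₀ (u₀⁻¹ * g) 1
  rw [mul_inv_cancel_left, mul_one] at h1
  have h2 := dist_triangle x (ι g) (ι u₀)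
  rw [dist_comm x (ι g)] at h2
  have h3 := le_max_right 0 (max K1 (R + 2 * δ + e))
  linarith

end Helpers2
section Helpers3

variable {X : Type*} [MetricSpace X] {G : Type*} [Group G] [MulAction G X]

theorem word_path {S : Set G} (hgen : Subgroup.closure S = ⊤) {ι : G → X}
    (hCay : IsCayleyGraph G S X ι) (g : G) :
    ∃ c : ℕ → G, c 0 = 1 ∧ c (wordLength S g) = g ∧
      ∀ i j, i ≤ j → j ≤ wordLength S g → dist (ι (c i)) (ι (c j)) = (j : ℝ) - i := by
  obtain ⟨L, hL, f, hf, hp⟩ : ∃ L, L = wordLength S g ∧ ∃ f : Fin L → G,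
      (∀ i, f i ∈ S ∨ (f i)⁻¹ ∈ S) ∧ (List.ofFn f).prod = g := ⟨_, rfl, exists_word S hgen g⟩
  rw [← hL]
  set l := List.ofFn f with hl
  have hlen : l.length = L := by simp [hl]
  have hmem : ∀ x ∈ l, x ∈ S ∨ x⁻¹ ∈ S := by
    intro x hx
    rw [hl, List.mem_ofFn] at hx
    obtain ⟨i, rfl⟩ := hx
    exact hf i
  let c : ℕ → G := fun i => (l.take i).prod
  have c0 : c 0 = 1 := by simp [c]
  have cL : c L = g := by
    have : l.take L = l := by rw [← hlen]; exact List.take_length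
    simp only [c, this, hp]
  have step : ∀ i, i < L → dist (ι (c i)) (ι (c (i + 1))) ≤ 1 := by
    intro i hi
    have hi' : i < l.length := by rw [hlen]; exact hi
    rw [hCay.2.2.2.2.1]
    have : (c i)⁻¹ * c (i + 1) = l[i] := by
      simp only [c]
      rw [List.prod_take_succ l i hi', inv_mul_cancel_left]
    rw [this]
    have : wordLength S l[i] ≤ 1 :=
      Nat.sInf_le ⟨fun _ : Fin 1 => l[i], fun _ => hmem _ (List.getElem_mem hi'), by simp⟩
    exact_mod_cast this
  have up : ∀ i k, i + k ≤ L → dist (ι (c i)) (ι (c (i + k))) ≤ k := by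
    intro i k
    induction k with
    | zero => simp
    | succ k ih =>
      intro h
      have h1 := ih (by omega)
      have h2 := step (i + k) (by omega)
      have h3 := dist_triangle (ι (c i)) (ι (c (i + k))) (ι (c (i + k + 1)))
      rw [← add_assoc]
      push_cast
      linarith
  refine ⟨c, c0, cL, fun i j hij hj => ?_⟩
  obtain ⟨k, rfl⟩ := Nat.exists_eq_add_of_le hij
  obtain ⟨m, hm⟩ := Nat.exists_eq_add_of_le hj
  have e1 := up 0 i (by omega)
  have e2 := up i k hj
  have e3 := up (i + k) m (by omega)
  rw [← hm, cL] at e3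
  rw [zero_add, c0] at e1
  have e4 : dist (ι 1) (ι g) = L := by rw [hCay.2.2.2.2.1, inv_one, one_mul, hL]
  have e5 := dist_triangle4 (ι 1) (ι (c i)) (ι (c (i + k))) (ι g)
  have e6 : (L : ℝ) = i + k + m := by exact_mod_cast hm
  push_cast
  linarith

theorem finite_path {S : Finset G} (hgen : Subgroup.closure (S : Set G) = ⊤) {ι : G → X}
    (hCay : IsCayleyGraph G (S : Set G) X ι) {e : ℝ} {U : Subgroup G} (hU : Infinite U)
    (hA : Quasiconvex e (ι '' (U : Set G))) {u₀ : G} (hu₀ : u₀ ∈ U) (n : ℕ) :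
    ∃ p : ℤ → G, (∀ i j : ℤ, |i| ≤ n → |j| ≤ n →
        dist (ι (p i)) (ι (p j)) = |(i : ℝ) - j|) ∧
      (∀ i : ℤ, |i| ≤ n → ∃ u ∈ U, dist (ι (p i)) (ι u) ≤ e) ∧ dist (ι (p 0)) (ι u₀) ≤ e := by
  obtain ⟨u, hu, hlen⟩ : ∃ u ∈ U, 2 * n < wordLength (S : Set G) u := by
    by_contra! hcon
    have : (U : Set G).Infinite := Set.infinite_coe_iff.1 hU
    exact this ((wl_ball_finite S hgen (2 * n)).subset hcon)
  obtain ⟨c, c0, c1, hc⟩ := word_path hgen hCay u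
  set L := wordLength (S : Set G) u
  have hnear : ∀ i, i ≤ L → ∃ a ∈ U, dist (ι (c i)) (ι a) ≤ e := by
    intro i hi
    have e1 := hc 0 i (Nat.zero_le _) hi
    have e2 := hc i L hi le_rfl
    have e3 := hc 0 L (Nat.zero_le _) le_rfl
    obtain ⟨s, hs, hm⟩ := seg_through hCay.2.2.2.1 (x := ι (c 0)) (y := ι (c i)) (z := ι (c L))
      (by rw [e1, e2, e3]; ring)
    obtain ⟨_, ⟨a, ha, rfl⟩, h⟩ := hA _ ⟨c 0, by rw [c0]; exact U.one_mem, rfl⟩ _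
      ⟨c L, by rw [c1]; exact hu, rfl⟩ s hs _ hm
    exact ⟨a, ha, h⟩
  obtain ⟨a, ha, han⟩ := hnear n (by omega)
  refine ⟨fun i => u₀ * a⁻¹ * c ((n + i).toNat), ?_, ?_, ?_⟩
  · intro i j hi hj
    rw [abs_le] at hi hj
    rw [dist_iota_left hCay]
    have ei : (((n + i).toNat : ℕ) : ℝ) = n + i := by
      have : (((n + i).toNat : ℕ) : ℤ) = n + i := Int.toNat_of_nonneg (by omega)
      exact_mod_cast this
    have ej : (((n + j).toNat : ℕ) : ℝ) = n + j := by
      have : (((n + j).toNat : ℕ) : ℤ) = n + j := Int.toNat_of_nonneg (by omega)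
      exact_mod_cast this
    rcases le_total i j with hij | hij
    · have hij' : (i : ℝ) ≤ j := by exact_mod_cast hij
      rw [hc _ _ (by omega) (by omega), ei, ej, abs_of_nonpos (by linarith)]; ring
    · have hij' : (j : ℝ) ≤ i := by exact_mod_cast hij
      rw [dist_comm, hc _ _ (by omega) (by omega), ei, ej, abs_of_nonneg (by linarith)]; ring
  · intro i hi
    rw [abs_le] at hi
    obtain ⟨b, hb, h⟩ := hnear (n + i).toNat (by omega)
    refine ⟨u₀ * a⁻¹ * b, U.mul_mem (U.mul_mem hu₀ (U.inv_mem ha)) hb, ?_⟩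
    rw [dist_iota_left hCay]; exact h
  · have h1 := dist_iota_left hCay (u₀ * a⁻¹) (c n) a
    rw [inv_mul_cancel_right] at h1
    simpa [h1] using han

theorem inf_path {S : Finset G} (hgen : Subgroup.closure (S : Set G) = ⊤) {ι : G → X}
    (hCay : IsCayleyGraph G (S : Set G) X ι) {e : ℝ} {U : Subgroup G} (hU : Infinite U)
    (hA : Quasiconvex e (ι '' (U : Set G))) {u₀ : G} (hu₀ : u₀ ∈ U) :
    ∃ p : ℤ → G, (∀ i j : ℤ, dist (ι (p i)) (ι (p j)) = |(i : ℝ) - j|) ∧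
      (∀ i : ℤ, ∃ u ∈ U, dist (ι (p i)) (ι u) ≤ e) ∧ dist (ι (p 0)) (ι u₀) ≤ e := by
  choose P h1 h2 h3 using finite_path hgen hCay hU hA hu₀
  have hlarge : ∀ i : ℤ, ∀ᶠ n : ℕ in (Filter.hyperfilter ℕ : Filter ℕ), |i| ≤ (n : ℤ) := by
    intro i
    have : ∀ᶠ n : ℕ in (Filter.atTop : Filter ℕ), |i| ≤ (n : ℤ) := by
      filter_upwards [Filter.eventually_ge_atTop i.natAbs] with n hn
      rw [Int.abs_eq_natAbs]
      exact_mod_cast hn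
    exact this.filter_mono Nat.hyperfilter_le_atTop
  have hlim : ∀ i : ℤ, ∃ g : G, ∀ᶠ n in (Filter.hyperfilter ℕ : Filter ℕ), P n i = g := by
    intro i
    have hfin := ball_finite hgen hCay u₀ (e + |(i : ℝ)|)
    have hmem : (⋃ g ∈ {g : G | dist (ι u₀) (ι g) ≤ e + |(i : ℝ)|}, {n : ℕ | P n i = g}) ∈
        Filter.hyperfilter ℕ := by
      refine Filter.mem_of_superset (hlarge i) ?_
      intro n hn
      simp only [Set.mem_iUnion]
      refine ⟨P n i, ?_, rfl⟩
      have a1 := h1 n 0 i (by simp) hn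
      have a2 := dist_triangle (ι u₀) (ι (P n 0)) (ι (P n i))
      have a3 := h3 n
      rw [dist_comm] at a3
      rw [Int.cast_zero, zero_sub, abs_neg] at a1
      show dist (ι u₀) (ι (P n i)) ≤ e + |(i : ℝ)|
      linarith
    obtain ⟨g, -, hg⟩ := (Ultrafilter.finite_biUnion_mem_iff hfin).1 hmem
    exact ⟨g, hg⟩
  choose p hp using hlim
  refine ⟨p, fun i j => ?_, fun i => ?_, ?_⟩
  · obtain ⟨n, hi, hj, hi', hj'⟩ :=
      ((hp i).and ((hp j).and ((hlarge i).and (hlarge j)))).exists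
    rw [← hi, ← hj]; exact h1 n i j hi' hj'
  · obtain ⟨n, hi, hi'⟩ := ((hp i).and (hlarge i)).exists
    rw [← hi]; exact h2 n i hi'
  · obtain ⟨n, hi⟩ := (hp 0).exists
    rw [← hi]; exact h3 n

theorem fill_path (hX : GeodesicSpace X) (p : ℤ → X)
    (hp : ∀ i j : ℤ, dist (p i) (p j) = |(i : ℝ) - j|) :
    ∃ γ : ℝ → X, IsBiGeodesic γ ∧ ∀ i : ℤ, γ i = p i := by
  have hpar : ∀ i : ℤ, ∃ f : ℝ → X, f 0 = p i ∧ f 1 = p (i + 1) ∧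
      ∀ u ∈ Set.Icc (0 : ℝ) 1, ∀ v ∈ Set.Icc (0 : ℝ) 1, dist (f u) (f v) = |u - v| := by
    intro i
    have h := geod_param hX (p i) (p (i + 1))
    have : dist (p i) (p (i + 1)) = 1 := by rw [hp]; simp
    rwa [this] at h
  choose f f0 f1 hf using hpar
  let γ : ℝ → X := fun t => f ⌊t⌋ (Int.fract t)
  have γi : ∀ i : ℤ, γ i = p i := by intro i; simp [γ, f0]
  have hfr : ∀ t : ℝ, Int.fract t ∈ Set.Icc (0 : ℝ) 1 :=
    fun t => ⟨Int.fract_nonneg t, (Int.fract_lt_one t).le⟩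
  have dl : ∀ t : ℝ, dist (p ⌊t⌋) (γ t) = t - ⌊t⌋ := by
    intro t
    rw [← f0, hf _ 0 ⟨le_rfl, zero_le_one⟩ _ (hfr t), zero_sub, abs_neg,
      abs_of_nonneg (Int.fract_nonneg t)]; rfl
  have dr : ∀ t : ℝ, dist (γ t) (p (⌊t⌋ + 1)) = ⌊t⌋ + 1 - t := by
    intro t
    rw [← f1, hf _ _ (hfr t) 1 ⟨zero_le_one, le_rfl⟩, abs_of_nonpos (by linarith [(hfr t).2])]
    rw [Int.fract]; ring
  have up : ∀ s t : ℝ, s ≤ t → dist (γ s) (γ t) ≤ t - s := by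
    intro s t hst
    rcases eq_or_lt_of_le (Int.floor_mono hst) with h | h
    · have : dist (γ s) (γ t) = |Int.fract s - Int.fract t| := by
        simp only [γ]
        rw [← h]
        exact hf _ _ (hfr s) _ (hfr t)
      rw [this]
      have hh : (⌊s⌋ : ℝ) = ⌊t⌋ := by exact_mod_cast h
      rw [Int.fract, Int.fract, hh, abs_of_nonpos (by linarith)]
      linarith
    · have h1 := dl t
      have h2 := dr s
      have h3 := hp (⌊s⌋ + 1) ⌊t⌋
      have h4 : ((⌊s⌋ : ℝ) + 1) ≤ ⌊t⌋ := by exact_mod_cast h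
      push_cast at h3
      rw [abs_of_nonpos (by linarith)] at h3
      have := dist_triangle4 (γ s) (p (⌊s⌋ + 1)) (p ⌊t⌋) (γ t)
      linarith
  have eqv : ∀ s t : ℝ, s ≤ t → dist (γ s) (γ t) = t - s := by
    intro s t hst
    refine le_antisymm (up s t hst) ?_
    have h1 := dl s
    have h2 := dr t
    have h3 := hp ⌊s⌋ (⌊t⌋ + 1)
    have h4 : (⌊s⌋ : ℝ) ≤ ⌊t⌋ := by exact_mod_cast Int.floor_mono hst
    push_cast at h3
    rw [abs_of_nonpos (by linarith)] at h3
    have := dist_triangle4 (p ⌊s⌋) (γ s) (γ t) (p (⌊t⌋ + 1))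
    linarith
  refine ⟨γ, fun s t => ?_, γi⟩
  rcases le_total s t with h | h
  · rw [eqv s t h, abs_of_nonpos (by linarith)]; ring
  · rw [dist_comm, eqv t s h, abs_of_nonneg (by linarith)]

theorem ray_mem_limit {S : Set G} {ι : G → X} (hCay : IsCayleyGraph G S X ι) {U : Subgroup G}
    {e : ℝ} {γ : ℝ → X} (hγ : IsGeodesicRay γ)
    (h : ∀ n : ℕ, ∃ u ∈ U, dist (γ n) (ι u) ≤ e) :
    Boundary.mk ⟨γ, hγ⟩ ∈ limitSet X U := by
  choose u hu hd using h
  refine ⟨ι 1, fun n => ⟨u n, hu n⟩, ⟨γ, hγ⟩, rfl, ?_⟩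
  intro M
  obtain ⟨N, hN⟩ := asym_gInf hγ hγ (asymptotic_refl γ) (M + e + dist (ι 1) (γ 0))
  refine ⟨N, fun n hn m hm => ?_⟩
  have h1 := hN n hn m hm
  have h2 := gromov_shift_base (ι 1) (γ 0) (γ n) (γ m)
  have h3 := gromov_shift (ι 1) (ι (u n)) (γ n) (γ m)
  have h4 := hd n
  rw [dist_comm] at h4
  simp only at h1 ⊢
  rw [smul_iota hCay]
  linarith

theorem near_hull {S : Finset G} (hgen : Subgroup.closure (S : Set G) = ⊤) {ι : G → X}
    (hCay : IsCayleyGraph G (S : Set G) X ι) {δ e : ℝ} {U : Subgroup G} (hU : Infinite U)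
    (hA : Quasiconvex e (ι '' (U : Set G))) {u₀ : G} (hu₀ : u₀ ∈ U) :
    ∃ b ∈ cHull X δ U, dist (ι u₀) b ≤ e := by
  obtain ⟨p, hp, hpU, hp0⟩ := inf_path hgen hCay hU hA hu₀
  obtain ⟨γ, hγ, hγp⟩ := fill_path hCay.2.2.2.1 (fun i => ι (p i)) hp
  have r1 : IsGeodesicRay γ := fun s t _ _ => hγ s t
  have r2 : IsGeodesicRay (fun t => γ (-t)) := by
    intro s t _ _
    show dist (γ (-s)) (γ (-t)) = _
    rw [hγ, abs_sub_comm]; congr 1; ring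
  have m1 : Boundary.mk ⟨γ, r1⟩ ∈ limitSet X U := by
    refine ray_mem_limit hCay (e := e) r1 fun n => ?_
    have := hγp n
    rw [Int.cast_natCast] at this
    rw [this]; exact hpU n
  have m2 : Boundary.mk ⟨fun t => γ (-t), r2⟩ ∈ limitSet X U := by
    refine ray_mem_limit hCay (e := e) r2 fun n => ?_
    have := hγp (-n)
    rw [Int.cast_neg, Int.cast_natCast] at this
    show ∃ u ∈ U, dist (γ (-n)) (ι u) ≤ e
    rw [this]; exact hpU (-n)
  have hne : Boundary.mk ⟨fun t => γ (-t), r2⟩ ≠ Boundary.mk ⟨γ, r1⟩ := by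
    intro h
    have h' : Asymptotic (fun t => γ (-t)) γ := Quotient.exact h
    obtain ⟨K, -, hK⟩ := h'
    obtain ⟨_, ⟨t, ht, rfl⟩, hd⟩ := hK (γ (|K| + 1)) ⟨|K| + 1, by
      show (0 : ℝ) ≤ _
      positivity, rfl⟩
    have ht : 0 ≤ t := ht
    have hd : dist (γ (-t)) (γ (|K| + 1)) ≤ K := hd
    rw [hγ, abs_of_nonpos (by linarith [abs_nonneg K])] at hd
    linarith [le_abs_self K]
  have hjoin : BiGeodesicJoins γ (Boundary.mk ⟨fun t => γ (-t), r2⟩) (Boundary.mk ⟨γ, r1⟩) := by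
    refine ⟨hγ, ?_, ray_conv ⟨r1, rfl⟩⟩
    have := ray_conv (γ := fun t => γ (-t)) ⟨r2, rfl⟩
    simpa using this
  have hZ : ∀ t, γ t ∈ ZSet X δ U := fun t =>
    Or.inr ⟨Sum.inr _, Or.inl ⟨_, m2, rfl⟩, Sum.inr _, Or.inl ⟨_, m1, rfl⟩,
      fun h => hne (Sum.inr.inj h), Set.range γ, ⟨γ, hjoin, rfl⟩, ⟨t, rfl⟩⟩
  have h01 : γ 0 ≠ γ 1 := by
    rw [← dist_pos, hγ]; norm_num
  refine ⟨γ 0, subset_closure (Or.inr ⟨Sum.inl (γ 0), ⟨_, hZ 0, rfl⟩, Sum.inl (γ 1),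
    ⟨_, hZ 1, rfl⟩, fun h => h01 (Sum.inl.inj h), γ '' Set.Icc 0 1,
    ⟨1, γ, zero_le_one, rfl, rfl, fun u _ v _ => hγ u v, rfl⟩,
    ⟨0, ⟨le_rfl, zero_le_one⟩, rfl⟩⟩), ?_⟩
  have := hγp 0
  rw [Int.cast_zero] at this
  rw [this, dist_comm]
  exact hp0

end Helpers3

theorem statement18 {G : Type u} {X : Type v} [Group G] [MetricSpace X] [MulAction G X]
    (S : Finset G) (hgen : Subgroup.closure (S : Set G) = ⊤) (ι : G → X)
    (hCay : IsCayleyGraph G (S : Set G) X ι) (δ : ℝ) (hδ : 0 < δ)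
    (hhyp : DeltaHyperbolic δ X) (hATF : AlmostTorsionFree G)
    (ε : ℕ) (hε : 0 < ε) :
    ∃ c₁ : ℝ, 0 < c₁ ∧ ∀ U : Subgroup G, Infinite ↥U →
      Quasiconvex (ε : ℝ) (ι '' (U : Set G)) →
      HClose c₁ (ι '' (U : Set G)) (cHull X δ U) := by
  have he : (0 : ℝ) ≤ ε := Nat.cast_nonneg ε
  obtain ⟨K, hK, hE⟩ := disp_near (e := (ε : ℝ)) hgen hCay hδ hhyp hATF
  refine ⟨4 * δ + K + 2 * ε + 1, by linarith, fun U hU hA => ⟨?_, ?_⟩⟩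
  · rintro _ ⟨u, hu, rfl⟩
    obtain ⟨b, hb, h⟩ := near_hull (δ := δ) hgen hCay hU hA hu
    exact ⟨b, hb, by linarith⟩
  · intro b hb
    obtain ⟨a, ha, h⟩ := hull_near hδ hhyp he hK hCay hA (hE U hA) b hb
    exact ⟨a, ha, by rwa [dist_comm]⟩

end KW
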